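/- arXiv:1002.4458 — 8 statements merged into one kernel-verified Lean document; each statement's English description precedes it below -/
import Mathlib

section
/- Let n ≥ 1, 1 ≤ k ≤ n, and α ∈ [0,1]. If 𝒮 is a family of k-element subsets of {1,…,n} such that every k-element subset s of {1,…,n} satisfies d(s,s') ≤ α for some s' ∈ 𝒮, then |𝒮| ≥ C(n,k) / (Σ_{a=0}^{⌊αk⌋} C(k,a)·C(n−k,a)), where C(·,·) denotes the binomial coefficient. -/
/-- The number of `k`-subsets `s` of a finite type with `|t \ s| ≤ m`, for a fixed `k`-subset `t`,
is at most `∑_{a=0}^{m} C(k,a)·C(n-k,a)`. -/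
theorem Finset.card_filter_powersetCard_card_sdiff_le {ι : Type*} [Fintype ι] [DecidableEq ι]
    (t : Finset ι) (m : ℕ) :
    ((Finset.univ.powersetCard t.card).filter fun s => (t \ s).card ≤ m).card ≤
      ∑ a ∈ Finset.range (m + 1), t.card.choose a * (Fintype.card ι - t.card).choose a := by
  calc
    _ ≤ ((Finset.range (m + 1)).biUnion fun a =>
          t.powersetCard a ×ˢ tᶜ.powersetCard a).card := by
      refine Finset.card_le_card_of_injOn (fun s => (t \ s, s \ t)) ?_ ?_
      · intro s hs
        simp only [Finset.coe_filter, Finset.mem_powersetCard_univ, Set.mem_ofPred_eq] at hs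
        simp only [Finset.mem_coe, Finset.mem_biUnion, Finset.mem_range, Finset.mem_product,
          Finset.mem_powersetCard]
        refine ⟨(t \ s).card, Nat.lt_succ_of_le hs.2, ⟨Finset.sdiff_subset, rfl⟩, ?_,
          Finset.card_sdiff_comm hs.1⟩
        intro x hx
        exact Finset.mem_compl.2 (Finset.mem_sdiff.1 hx).2
      · intro s _ s' _ h
        simp only [Prod.mk.injEq, Finset.ext_iff, Finset.mem_sdiff] at h
        ext x
        have h₁ := h.1 x
        have h₂ := h.2 x
        tauto
    _ ≤ ∑ a ∈ Finset.range (m + 1), (t.powersetCard a ×ˢ tᶜ.powersetCard a).card :=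
      Finset.card_biUnion_le
    _ = _ := by
      simp only [Finset.card_product, Finset.card_powersetCard, Finset.card_compl]

/-- Covering-number lower bound: any family `𝒮` of `k`-subsets of `{1,…,n}` that covers
every `k`-subset within distortion `α` (where `d(s,s') = 1 - |s ∩ s'|/k`) has cardinality
at least `C(n,k) / ∑_{a=0}^{⌊αk⌋} C(k,a)·C(n−k,a)`. -/
theorem stmt1 (n k : ℕ) (α : ℝ) (hn : 1 ≤ n) (hk1 : 1 ≤ k) (hkn : k ≤ n)
    (hα0 : 0 ≤ α) (hα1 : α ≤ 1) (𝒮 : Finset (Finset (Fin n)))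
    (hmem : ∀ s' ∈ 𝒮, s'.card = k)
    (hcover : ∀ s : Finset (Fin n), s.card = k →
      ∃ s' ∈ 𝒮, 1 - ((s ∩ s').card : ℝ) / (k : ℝ) ≤ α) :
    (n.choose k : ℝ) /
        (∑ a ∈ Finset.range (⌊α * (k : ℝ)⌋₊ + 1), (k.choose a * (n - k).choose a : ℕ)) ≤
      (𝒮.card : ℝ) := by
  have hk : (0 : ℝ) < k := by exact_mod_cast hk1
  have hsub : Finset.univ.powersetCard k ⊆ 𝒮.biUnion fun t =>
      (Finset.univ.powersetCard k).filter fun s => (t \ s).card ≤ ⌊α * (k : ℝ)⌋₊ := by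
    intro s hs
    obtain ⟨t, ht, hd⟩ := hcover s (Finset.mem_powersetCard_univ.1 hs)
    refine Finset.mem_biUnion.2 ⟨t, ht, Finset.mem_filter.2 ⟨hs, Nat.le_floor ?_⟩⟩
    have hcard : ((t \ s).card : ℝ) + (s ∩ t).card = k := by
      rw [Finset.inter_comm, ← hmem t ht]
      exact_mod_cast Finset.card_sdiff_add_card_inter t s
    have hscaled := mul_le_mul_of_nonneg_right hd hk.le
    rw [sub_mul, one_mul, div_mul_cancel₀ _ hk.ne'] at hscaled
    linarith
  have hcount : n.choose k ≤ 𝒮.card *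
      ∑ a ∈ Finset.range (⌊α * (k : ℝ)⌋₊ + 1), k.choose a * (n - k).choose a := by
    have hle := (Finset.card_le_card hsub).trans
      (Finset.card_biUnion_le_card_mul _ _ _ fun t ht => by
        simpa only [hmem t ht, Fintype.card_fin] using
          Finset.card_filter_powersetCard_card_sdiff_le t ⌊α * (k : ℝ)⌋₊)
    simpa only [Finset.card_powersetCard, Finset.card_univ, Fintype.card_fin] using hle
  refine div_le_of_le_mul₀ (by positivity) (by positivity) ?_
  exact_mod_cast hcount
end

section
/- Fix a sparsity rate Ω ∈ (0,1/2] and a distortion α ∈ [0,1]. For each n, let k_n = ⌊Ω·n⌋, let 𝒮ⁿ_Ω be the collection of all k_n-element subsets of {1,…,n}, and let N_n(Ω,α) be the cardinality of the smallest family 𝒮 ⊆ 𝒮ⁿ_Ω such that for every s ∈ 𝒮ⁿ_Ω there exists s' ∈ 𝒮 with d(s,s') ≤ α. Then lim_{n→∞} (1/n)·log N_n(Ω,α) = R(Ω,α). -/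
open Filter

/-- Binary entropy function (natural logarithm). -/
noncomputable def binEnt (p : ℝ) : ℝ := -p * Real.log p - (1 - p) * Real.log (1 - p)

/-- The rate function `R(Ω,α)` of the paper. -/
noncomputable def rateR (Ω α : ℝ) : ℝ :=
  if α < 1 - Ω then binEnt Ω - Ω * binEnt α - (1 - Ω) * binEnt (Ω * α / (1 - Ω)) else 0

open Classical in
/-- `N_n(Ω,α)`: the cardinality of the smallest family `𝒮` of `⌊Ωn⌋`-subsets of `{1,…,n}`
such that every `⌊Ωn⌋`-subset `s` satisfies `d(s,s') = 1 - |s ∩ s'|/|s| ≤ α` for some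
`s' ∈ 𝒮`. -/
noncomputable def Ncov (Ω α : ℝ) (n : ℕ) : ℕ :=
  sInf {m : ℕ | ∃ 𝒮 : Finset (Finset (Fin n)),
    𝒮.card = m ∧ (∀ s ∈ 𝒮, s.card = ⌊Ω * (n : ℝ)⌋₊) ∧
    ∀ s : Finset (Fin n), s.card = ⌊Ω * (n : ℝ)⌋₊ →
      ∃ s' ∈ 𝒮, 1 - ((s ∩ s').card : ℝ) / (s.card : ℝ) ≤ α}

section Covering

variable {ι : Type*} [DecidableEq ι]

/-- Greedy covering: `M` centres leave at most a `(1 - T/|X|)^M` fraction of `X` uncovered when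
every point of `X` is related to at least `T` centres. -/
lemma exists_greedy_cover (X : Finset ι) (r : ι → ι → Prop) [DecidableRel r] (T : ℕ)
    (hX : X.Nonempty) (hT : ∀ x ∈ X, T ≤ (X.filter fun y => r x y).card)
    (hTX : T ≤ X.card) (M : ℕ) :
    ∃ S ⊆ X, S.card ≤ M ∧
      ((X.filter fun x => ∀ y ∈ S, ¬ r x y).card : ℝ) ≤ X.card * (1 - (T : ℝ) / X.card) ^ M := by
  have hXpos : (0 : ℝ) < X.card := by exact_mod_cast hX.card_pos
  induction M with
  | zero => exact ⟨∅, by simp, by simp, by simp⟩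
  | succ M ih =>
    obtain ⟨S, hSX, hSM, hS⟩ := ih
    set U := X.filter fun x => ∀ y ∈ S, ¬ r x y with hU
    have hdouble : ∑ y ∈ X, (U.filter fun x => r x y).card
        = ∑ x ∈ U, (X.filter fun y => r x y).card := by
      simp only [Finset.card_filter]
      exact Finset.sum_comm
    have hsum : U.card * T ≤ ∑ y ∈ X, (U.filter fun x => r x y).card := by
      rw [hdouble, ← smul_eq_mul]
      exact Finset.card_nsmul_le_sum _ _ _ fun x hx => hT x (Finset.mem_filter.1 hx).1
    obtain ⟨y, hyX, hy⟩ : ∃ y ∈ X, (U.card * T : ℝ) / X.card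
        ≤ ((U.filter fun x => r x y).card : ℝ) := by
      apply Finset.exists_le_of_sum_le hX
      rw [Finset.sum_const, nsmul_eq_mul, mul_div_cancel₀ _ hXpos.ne']
      exact_mod_cast hsum
    refine ⟨insert y S, Finset.insert_subset hyX hSX, (Finset.card_insert_le _ _).trans (by lia), ?_⟩
    have hrest : (X.filter fun x => ∀ z ∈ insert y S, ¬ r x z) = U.filter fun x => ¬ r x y := by
      ext x
      simp only [hU, Finset.mem_filter, Finset.mem_insert, forall_eq_or_imp]
      tauto
    have hsplit : ((U.filter fun x => r x y).card : ℝ) + (U.filter fun x => ¬ r x y).card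
        = U.card := by
      exact_mod_cast Finset.card_filter_add_card_filter_not (s := U) (fun x => r x y)
    have hfrac : (0 : ℝ) ≤ 1 - (T : ℝ) / X.card := by
      rw [sub_nonneg, div_le_one hXpos]
      exact_mod_cast hTX
    calc ((X.filter fun x => ∀ z ∈ insert y S, ¬ r x z).card : ℝ)
        ≤ U.card - (U.card * T : ℝ) / X.card := by rw [hrest]; linarith
      _ = U.card * (1 - (T : ℝ) / X.card) := by ring
      _ ≤ X.card * (1 - (T : ℝ) / X.card) ^ M * (1 - (T : ℝ) / X.card) := by gcongr
      _ = X.card * (1 - (T : ℝ) / X.card) ^ (M + 1) := by ring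

lemma exists_cover_card_le (X : Finset ι) (r : ι → ι → Prop) [DecidableRel r] (T : ℕ)
    (hX : X.Nonempty) (hT0 : 0 < T) (hT : ∀ x ∈ X, T ≤ (X.filter fun y => r x y).card) :
    ∃ S ⊆ X, (∀ x ∈ X, ∃ y ∈ S, r x y) ∧
      (S.card : ℝ) ≤ (X.card : ℝ) / T * (Real.log X.card + 1) := by
  have hXpos : (0 : ℝ) < X.card := by exact_mod_cast hX.card_pos
  have hTpos : (0 : ℝ) < T := by exact_mod_cast hT0
  have hTX : T ≤ X.card := by
    obtain ⟨x, hx⟩ := hX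
    exact (hT x hx).trans (Finset.card_filter_le _ _)
  have hlog : 0 ≤ Real.log X.card := Real.log_natCast_nonneg _
  set a : ℝ := (X.card : ℝ) / T * Real.log X.card with ha
  have ha0 : 0 ≤ a := by positivity
  obtain ⟨S, hSX, hSM, hS⟩ := exists_greedy_cover X r T hX hT hTX (⌊a⌋₊ + 1)
  have hlt : (X.card : ℝ) * (1 - (T : ℝ) / X.card) ^ (⌊a⌋₊ + 1) < 1 := by
    have hfrac : (0 : ℝ) ≤ 1 - (T : ℝ) / X.card := by
      rw [sub_nonneg, div_le_one hXpos]
      exact_mod_cast hTX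
    have hexp : (1 - (T : ℝ) / X.card) ^ (⌊a⌋₊ + 1)
        ≤ Real.exp (((⌊a⌋₊ + 1 : ℕ) : ℝ) * (-((T : ℝ) / X.card))) := by
      rw [Real.exp_nat_mul]
      gcongr
      exact Real.one_sub_le_exp_neg _
    have hmul : Real.log X.card < ((⌊a⌋₊ + 1 : ℕ) : ℝ) * ((T : ℝ) / X.card) := by
      have h1 : a < ((⌊a⌋₊ + 1 : ℕ) : ℝ) := by push_cast; exact Nat.lt_floor_add_one a
      have h2 : Real.log X.card = a * ((T : ℝ) / X.card) := by rw [ha]; field_simp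
      exact h2.trans_lt (mul_lt_mul_of_pos_right h1 (div_pos hTpos hXpos))
    calc (X.card : ℝ) * (1 - (T : ℝ) / X.card) ^ (⌊a⌋₊ + 1)
        ≤ Real.exp (Real.log X.card)
          * Real.exp (((⌊a⌋₊ + 1 : ℕ) : ℝ) * (-((T : ℝ) / X.card))) := by
          rw [Real.exp_log hXpos]; gcongr
      _ = Real.exp (Real.log X.card - ((⌊a⌋₊ + 1 : ℕ) : ℝ) * ((T : ℝ) / X.card)) := by
          rw [← Real.exp_add]; ring_nf
      _ < 1 := by rw [Real.exp_lt_one_iff]; linarith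
  have hempty : (X.filter fun x => ∀ y ∈ S, ¬ r x y) = ∅ := by
    rw [← Finset.card_eq_zero]
    have := hS.trans_lt hlt
    have : (X.filter fun x => ∀ y ∈ S, ¬ r x y).card < 1 := by exact_mod_cast this
    lia
  refine ⟨S, hSX, fun x hx => ?_, ?_⟩
  · have := Finset.filter_eq_empty_iff.1 hempty hx
    push Not at this
    exact this
  · have h1 : (S.card : ℝ) ≤ (⌊a⌋₊ : ℝ) + 1 := by exact_mod_cast hSM
    have h2 := Nat.floor_le ha0
    have h3 : (1 : ℝ) ≤ (X.card : ℝ) / T := by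
      rw [one_le_div hTpos]
      exact_mod_cast hTX
    linarith

end Covering

section Johnson

/-- The number of `k`-subsets at Johnson distance `j` from a fixed `k`-subset. -/
lemma card_filter_card_sdiff_eq {n k j : ℕ} (s : Finset (Fin n)) (hs : s.card = k) (hj : j ≤ k) :
    ((Finset.univ : Finset (Finset (Fin n))).filter
      fun t => t.card = k ∧ (s \ t).card = j).card = k.choose j * (n - k).choose j := by
  have hprod : (s.powersetCard (k - j) ×ˢ sᶜ.powersetCard j).card
      = k.choose j * (n - k).choose j := by
    rw [Finset.card_product, Finset.card_powersetCard, Finset.card_powersetCard,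
      Finset.card_compl, Fintype.card_fin, hs, Nat.choose_symm hj]
  rw [← hprod]
  refine Finset.card_bij' (fun t _ => (s ∩ t, t \ s)) (fun p _ => p.1 ∪ p.2) ?_ ?_ ?_ ?_
  · intro t ht
    obtain ⟨-, htk, htj⟩ := Finset.mem_filter.1 ht
    have h1 := Finset.card_inter_add_card_sdiff s t
    have h2 := Finset.card_inter_add_card_sdiff t s
    rw [Finset.inter_comm t s] at h2
    simp only [Finset.mem_product, Finset.mem_powersetCard]
    refine ⟨⟨Finset.inter_subset_left, by lia⟩, fun x hx => ?_, by lia⟩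
    simpa using (Finset.mem_sdiff.1 hx).2
  · rintro ⟨p, q⟩ hpq
    simp only [Finset.mem_product, Finset.mem_powersetCard] at hpq
    obtain ⟨⟨hps, hpc⟩, hqs, hqc⟩ := hpq
    have hdisj : Disjoint s q := Finset.subset_compl_iff_disjoint_left.1 hqs
    have hpq : Disjoint p q := hdisj.mono_left hps
    have hsd : s \ (p ∪ q) = s \ p := by
      ext x
      have hx : x ∈ s → x ∉ q := fun h => Finset.disjoint_left.1 hdisj h
      simp only [Finset.mem_sdiff, Finset.mem_union]
      tauto
    simp only [Finset.mem_filter, Finset.mem_univ, true_and]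
    rw [hsd, Finset.card_union_of_disjoint hpq, Finset.card_sdiff_of_subset hps]
    lia
  · intro t _
    ext x
    simp only [Finset.mem_union, Finset.mem_inter, Finset.mem_sdiff]
    tauto
  · rintro ⟨p, q⟩ hpq
    simp only [Finset.mem_product, Finset.mem_powersetCard] at hpq
    obtain ⟨⟨hps, -⟩, hqs, -⟩ := hpq
    have hdisj : Disjoint s q := Finset.subset_compl_iff_disjoint_left.1 hqs
    ext x
    · have hx : x ∈ s → x ∉ q := fun h => Finset.disjoint_left.1 hdisj h
      have hxp : x ∈ p → x ∈ s := fun h => hps h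
      have hxq : x ∈ q → x ∉ s := fun h h' => hx h' h
      simp only [Finset.mem_union, Finset.mem_inter]
      tauto
    · have hx : x ∈ s → x ∉ q := fun h => Finset.disjoint_left.1 hdisj h
      have hxp : x ∈ p → x ∈ s := fun h => hps h
      have hxq : x ∈ q → x ∉ s := fun h h' => hx h' h
      simp only [Finset.mem_union, Finset.mem_sdiff]
      tauto

/-- Johnson sphere sizes increase up to any radius `m` with `m * n ≤ k * (n - k)`. -/
lemma choose_mul_choose_le {n k m j : ℕ} (hmk : m ≤ k) (hkn : 2 * k ≤ n)
    (h : m * n ≤ k * (n - k)) (hj : j ≤ m) :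
    k.choose j * (n - k).choose j ≤ k.choose m * (n - k).choose m := by
  obtain ⟨l, rfl⟩ : ∃ l, n = k + l := ⟨n - k, by lia⟩
  simp only [Nat.add_sub_cancel_left] at h ⊢
  suffices hstep : ∀ i, i < m → k.choose i * l.choose i ≤ k.choose (i + 1) * l.choose (i + 1) by
    induction m, hj using Nat.le_induction with
    | base => rfl
    | succ m hjm ih =>
      refine (ih (by lia) (by nlinarith) fun i hi => hstep i (by lia)).trans (hstep m (by lia))
  intro i hi
  have hk := Nat.choose_succ_right_eq k i
  have hl := Nat.choose_succ_right_eq l i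
  have hsq : (i + 1) * (i + 1) ≤ (k - i) * (l - i) := by
    obtain ⟨a, rfl⟩ : ∃ a, k = m + a := ⟨k - m, by lia⟩
    obtain ⟨b, rfl⟩ : ∃ b, l = m + b := ⟨l - m, by lia⟩
    have hab : m * m ≤ a * b := by nlinarith
    calc (i + 1) * (i + 1) ≤ m * m := Nat.mul_le_mul hi hi
      _ ≤ a * b := hab
      _ ≤ _ := Nat.mul_le_mul (by lia) (by lia)
  refine Nat.le_of_mul_le_mul_right (c := (i + 1) * (i + 1)) ?_ (by positivity)
  calc k.choose i * l.choose i * ((i + 1) * (i + 1))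
      ≤ k.choose i * l.choose i * ((k - i) * (l - i)) := Nat.mul_le_mul_left _ hsq
    _ = (k.choose i * (k - i)) * (l.choose i * (l - i)) := by ring
    _ = k.choose (i + 1) * l.choose (i + 1) * ((i + 1) * (i + 1)) := by rw [← hk, ← hl]; ring

lemma distortion_le_iff {n k : ℕ} {α : ℝ} (hα : 0 ≤ α) (s t : Finset (Fin n)) (hk : 0 < k)
    (hs : s.card = k) :
    1 - ((s ∩ t).card : ℝ) / (s.card : ℝ) ≤ α ↔ (s \ t).card ≤ ⌊α * (k : ℝ)⌋₊ := by
  have hkpos : (0 : ℝ) < k := by exact_mod_cast hk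
  have h : ((s ∩ t).card : ℝ) + (s \ t).card = k := by
    rw [← hs]
    exact_mod_cast Finset.card_inter_add_card_sdiff s t
  rw [Nat.le_floor_iff (by positivity), hs, ← sub_nonneg, ← sub_nonneg (b := ((s \ t).card : ℝ)),
    ← mul_nonneg_iff_of_pos_right hkpos]
  have : (α - (1 - ((s ∩ t).card : ℝ) / k)) * k = α * k - (s \ t).card := by
    field_simp
    linarith
  rw [this]

end Johnson

section Bounds

variable {Ω α : ℝ} {n k : ℕ}

lemma exists_cover_card_eq_Ncov (hα : 0 ≤ α) (hk : k = ⌊Ω * (n : ℝ)⌋₊) (hk0 : 0 < k) :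
    ∃ S : Finset (Finset (Fin n)), S.card = Ncov Ω α n ∧ (∀ s ∈ S, s.card = k) ∧
      ∀ s : Finset (Fin n), s.card = k → ∃ t ∈ S, (s \ t).card ≤ ⌊α * (k : ℝ)⌋₊ := by
  classical
  have hne : {m : ℕ | ∃ 𝒮 : Finset (Finset (Fin n)),
    𝒮.card = m ∧ (∀ s ∈ 𝒮, s.card = ⌊Ω * (n : ℝ)⌋₊) ∧
    ∀ s : Finset (Fin n), s.card = ⌊Ω * (n : ℝ)⌋₊ →
      ∃ s' ∈ 𝒮, 1 - ((s ∩ s').card : ℝ) / (s.card : ℝ) ≤ α}.Nonempty := by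
    refine ⟨_, Finset.univ.filter fun s => s.card = k, rfl, by simp [hk], fun s hs => ?_⟩
    rw [← hk] at hs
    refine ⟨s, by simpa using hs, ?_⟩
    rw [distortion_le_iff hα s s hk0 hs]
    simp
  obtain ⟨S, hS1, hS2, hS3⟩ := Nat.sInf_mem hne
  refine ⟨S, ?_, by rwa [hk], fun s hs => ?_⟩
  · rw [hS1, Ncov]
  · obtain ⟨t, ht, hst⟩ := hS3 s (by rw [hs, hk])
    refine ⟨t, ht, (distortion_le_iff hα s t hk0 hs).1 ?_⟩
    convert hst

lemma Ncov_le_card (hα : 0 ≤ α) (hk : k = ⌊Ω * (n : ℝ)⌋₊) (hk0 : 0 < k)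
    (S : Finset (Finset (Fin n))) (hS : ∀ s ∈ S, s.card = k)
    (hcov : ∀ s : Finset (Fin n), s.card = k → ∃ t ∈ S, (s \ t).card ≤ ⌊α * (k : ℝ)⌋₊) :
    Ncov Ω α n ≤ S.card := by
  refine Nat.sInf_le ⟨S, rfl, by rwa [← hk], fun s hs => ?_⟩
  rw [← hk] at hs
  obtain ⟨t, ht, hst⟩ := hcov s hs
  refine ⟨t, ht, ?_⟩
  convert (distortion_le_iff hα s t hk0 hs).2 hst

lemma card_filter_card_eq (n k : ℕ) :
    ((Finset.univ : Finset (Finset (Fin n))).filter fun s => s.card = k).card = n.choose k := by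
  simp

lemma Ncov_pos (hα : 0 ≤ α) (hk : k = ⌊Ω * (n : ℝ)⌋₊) (hk0 : 0 < k) (hkn : k ≤ n) :
    0 < Ncov Ω α n := by
  obtain ⟨S, hS, -, hcov⟩ := exists_cover_card_eq_Ncov (Ω := Ω) hα hk hk0
  obtain ⟨s, -, hs⟩ := Finset.exists_subset_card_eq (s := (Finset.univ : Finset (Fin n)))
    (n := k) (by simpa using hkn)
  obtain ⟨t, ht, -⟩ := hcov s hs
  rw [← hS]
  exact Finset.card_pos.2 ⟨t, ht⟩

lemma Ncov_le (hα : 0 ≤ α) (hk : k = ⌊Ω * (n : ℝ)⌋₊) (hk0 : 0 < k) (hkn : 2 * k ≤ n) {j : ℕ}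
    (hj : j ≤ k) (hjα : j ≤ ⌊α * (k : ℝ)⌋₊) :
    (Ncov Ω α n : ℝ) ≤ (n.choose k : ℝ) / (k.choose j * (n - k).choose j) * (n + 1) := by
  classical
  set X : Finset (Finset (Fin n)) := Finset.univ.filter fun s => s.card = k with hX
  have hXcard : X.card = n.choose k := card_filter_card_eq n k
  have hXpos : 0 < X.card := by rw [hXcard]; exact Nat.choose_pos (by lia)
  have hTpos : 0 < k.choose j * (n - k).choose j :=
    Nat.mul_pos (Nat.choose_pos hj) (Nat.choose_pos (by lia))
  obtain ⟨S, hSX, hcov, hScard⟩ := exists_cover_card_le X (fun s t => (s \ t).card = j)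
    (k.choose j * (n - k).choose j) (Finset.card_pos.1 hXpos) hTpos (by
      intro s hs
      rw [← card_filter_card_sdiff_eq s (Finset.mem_filter.1 hs).2 hj, hX, Finset.filter_filter])
  have hle : Ncov Ω α n ≤ S.card := by
    refine Ncov_le_card hα hk hk0 S (fun s hs => (Finset.mem_filter.1 (hSX hs)).2) fun s hs => ?_
    obtain ⟨t, ht, hst⟩ := hcov s (by simpa [hX] using hs)
    exact ⟨t, ht, hst.le.trans hjα⟩
  have hlog : Real.log X.card ≤ n := by
    rw [hXcard]
    have h1 : (n.choose k : ℝ) ≤ 2 ^ n := by exact_mod_cast Nat.choose_le_two_pow n k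
    have h2 : (0 : ℝ) < n.choose k := by rw [← hXcard]; exact_mod_cast hXpos
    calc Real.log (n.choose k) ≤ Real.log (2 ^ n) := Real.log_le_log h2 h1
      _ = n * Real.log 2 := by rw [Real.log_pow]
      _ ≤ n * 1 := by gcongr; linarith [Real.log_two_lt_d9]
      _ = n := mul_one _
  calc (Ncov Ω α n : ℝ) ≤ S.card := by exact_mod_cast hle
    _ ≤ _ := hScard
    _ ≤ (X.card : ℝ) / (k.choose j * (n - k).choose j : ℕ) * (n + 1) := by gcongr
    _ = _ := by rw [hXcard]; push_cast; rfl

lemma choose_le_Ncov_mul (hα : 0 ≤ α) (hk : k = ⌊Ω * (n : ℝ)⌋₊) (hk0 : 0 < k)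
    (hkn : 2 * k ≤ n) {m : ℕ} (hm : m = ⌊α * (k : ℝ)⌋₊) (hmk : m ≤ k)
    (h : m * n ≤ k * (n - k)) :
    n.choose k ≤ Ncov Ω α n * ((m + 1) * (k.choose m * (n - k).choose m)) := by
  classical
  obtain ⟨S, hS, hSk, hcov⟩ := exists_cover_card_eq_Ncov (Ω := Ω) hα hk hk0
  rw [← card_filter_card_eq, ← hS, ← hm] at *
  have hsub : (Finset.univ.filter fun s : Finset (Fin n) => s.card = k) ⊆
      S.biUnion fun t => (Finset.range (m + 1)).biUnion fun j =>
        Finset.univ.filter fun s => s.card = k ∧ (t \ s).card = j := by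
    intro s hs
    have hs' : s.card = k := by simpa using hs
    obtain ⟨t, ht, hst⟩ := hcov s hs'
    have h1 := Finset.card_inter_add_card_sdiff s t
    have h2 := Finset.card_inter_add_card_sdiff t s
    rw [Finset.inter_comm t s, hSk t ht] at h2
    simp only [Finset.mem_biUnion, Finset.mem_range, Finset.mem_filter, Finset.mem_univ, true_and]
    exact ⟨t, ht, _, by lia, hs', rfl⟩
  refine (Finset.card_le_card hsub).trans (Finset.card_biUnion_le_card_mul _ _ _ fun t ht => ?_)
  refine (Finset.card_biUnion_le_card_mul _ _ _ fun j hj => ?_).trans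
    (Nat.mul_le_mul_right _ (Finset.card_range _).le)
  have hjm : j ≤ m := by simpa [Nat.lt_succ_iff] using hj
  rw [card_filter_card_sdiff_eq t (hSk t ht) (hjm.trans hmk)]
  exact choose_mul_choose_le hmk hkn h hjm

end Bounds

section Asymptotics

open Real

lemma log_factorial_ge (x : ℕ) : x * log x - x ≤ log (x.factorial : ℝ) := by
  induction x with
  | zero => simp
  | succ x ih =>
    rcases Nat.eq_zero_or_pos x with rfl | hx
    · simp
    have hx' : (0 : ℝ) < x := by exact_mod_cast hx
    have hfac : log ((x + 1).factorial : ℝ) = log (x + 1) + log x.factorial := by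
      rw [Nat.factorial_succ]
      push_cast
      exact log_mul (by positivity) (by positivity)
    have hlog : log (x + 1) - log x ≤ 1 / x := by
      rw [← log_div (by positivity) (by positivity)]
      refine (log_le_sub_one_of_pos (by positivity)).trans (le_of_eq ?_)
      field_simp
      ring
    have := mul_le_mul_of_nonneg_left hlog hx'.le
    rw [mul_one_div_cancel hx'.ne'] at this
    rw [hfac]
    push_cast
    linarith

lemma log_factorial_le (x : ℕ) :
    log (x.factorial : ℝ) ≤ ((x : ℝ) + 1) * log ((x : ℝ) + 1) - x := by
  induction x with
  | zero => simp
  | succ x ih =>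
    have hfac : log ((x + 1).factorial : ℝ) = log (x + 1) + log x.factorial := by
      rw [Nat.factorial_succ]
      push_cast
      exact log_mul (by positivity) (by positivity)
    have hlog : 1 / ((x : ℝ) + 2) ≤ log (x + 2) - log (x + 1) := by
      have h := log_le_sub_one_of_pos (x := ((x : ℝ) + 1) / (x + 2)) (by positivity)
      rw [log_div (by positivity) (by positivity)] at h
      have : ((x : ℝ) + 1) / (x + 2) - 1 = -(1 / (x + 2)) := by
        field_simp
        ring
      linarith
    have := mul_le_mul_of_nonneg_left hlog (by positivity : (0 : ℝ) ≤ x + 2)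
    rw [mul_one_div_cancel (by positivity)] at this
    rw [hfac]
    push_cast
    rw [show (x : ℝ) + 1 + 1 = x + 2 by ring]
    linarith

lemma tendsto_log_natCast_div : Tendsto (fun n : ℕ => log n / n) atTop (nhds 0) := by
  exact isLittleO_log_id_atTop.tendsto_div_nhds_zero.comp tendsto_natCast_atTop_atTop

/-- Stirling's formula at linear scale. -/
lemma tendsto_log_factorial {x : ℕ → ℕ} {X : ℝ}
    (hx : Tendsto (fun n => (x n : ℝ) / n) atTop (nhds X)) :
    Tendsto (fun n : ℕ => log ((x n).factorial : ℝ) / n - (x n : ℝ) / n * log n) atTop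
      (nhds (X * log X - X)) := by
  have hx1 : Tendsto (fun n => ((x n : ℝ) + 1) / n) atTop (nhds X) := by
    have := hx.add (tendsto_one_div_atTop_nhds_zero_nat (𝕜 := ℝ))
    simpa [add_div] using this
  have hlow : Tendsto (fun n : ℕ => (x n : ℝ) / n * log ((x n : ℝ) / n) - (x n : ℝ) / n) atTop
      (nhds (X * log X - X)) :=
    ((continuous_mul_log.tendsto X).comp hx).sub hx
  have hup : Tendsto (fun n : ℕ => ((x n : ℝ) + 1) / n * log (((x n : ℝ) + 1) / n) + log n / n
      - (x n : ℝ) / n) atTop (nhds (X * log X - X)) := by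
    have := (((continuous_mul_log.tendsto X).comp hx1).add tendsto_log_natCast_div).sub hx
    simpa using this
  refine tendsto_of_tendsto_of_tendsto_of_le_of_le' hlow hup ?_ ?_
  · filter_upwards [eventually_gt_atTop 0] with n hn
    have hn' : (0 : ℝ) < n := by exact_mod_cast hn
    have h := div_le_div_of_nonneg_right (log_factorial_ge (x n)) hn'.le
    rcases Nat.eq_zero_or_pos (x n) with h0 | h0
    · simp [h0]
    have h0' : (0 : ℝ) < x n := by exact_mod_cast h0
    rw [log_div h0'.ne' hn'.ne']
    have : ((x n : ℝ) * log (x n) - x n) / n = (x n : ℝ) / n * log (x n) - (x n : ℝ) / n := by ring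
    linarith
  · filter_upwards [eventually_gt_atTop 0] with n hn
    have hn' : (0 : ℝ) < n := by exact_mod_cast hn
    have h := div_le_div_of_nonneg_right (log_factorial_le (x n)) hn'.le
    rw [log_div (by positivity) hn'.ne']
    have : (((x n : ℝ) + 1) * log ((x n : ℝ) + 1) - x n) / n
        = ((x n : ℝ) + 1) / n * log ((x n : ℝ) + 1) - (x n : ℝ) / n := by ring
    have : ((x n : ℝ) + 1) / n * (log ((x n : ℝ) + 1) - log n)
      = ((x n : ℝ) + 1) / n * log ((x n : ℝ) + 1) - (x n : ℝ) / n * log n - log n / n := by ring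
    linarith

lemma tendsto_log_choose {a b : ℕ → ℕ} {A B : ℝ} (hba : ∀ᶠ n in atTop, b n ≤ a n)
    (ha : Tendsto (fun n => (a n : ℝ) / n) atTop (nhds A))
    (hb : Tendsto (fun n => (b n : ℝ) / n) atTop (nhds B)) :
    Tendsto (fun n : ℕ => log ((a n).choose (b n) : ℝ) / n) atTop
      (nhds (negMulLog B + negMulLog (A - B) - negMulLog A)) := by
  have hc : Tendsto (fun n => ((a n - b n : ℕ) : ℝ) / n) atTop (nhds (A - B)) := by
    refine (ha.sub hb).congr' ?_
    filter_upwards [hba] with n hn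
    rw [Nat.cast_sub hn, sub_div]
  have h := ((tendsto_log_factorial ha).sub (tendsto_log_factorial hb)).sub
    (tendsto_log_factorial hc)
  have hlim : A * log A - A - (B * log B - B) - ((A - B) * log (A - B) - (A - B))
      = negMulLog B + negMulLog (A - B) - negMulLog A := by
    simp only [negMulLog]
    ring
  rw [hlim] at h
  refine h.congr' ?_
  filter_upwards [hba] with n hn
  have hfac : log ((a n).factorial : ℝ)
      = log ((a n).choose (b n) : ℝ) + log ((b n).factorial : ℝ)
        + log ((a n - b n).factorial : ℝ) := by
    have hpos : (0 : ℝ) < (a n).choose (b n) := by exact_mod_cast Nat.choose_pos hn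
    rw [← log_mul (by positivity) (by positivity), ← log_mul (by positivity) (by positivity)]
    exact_mod_cast congrArg (fun t : ℕ => log (t : ℝ)) (Nat.choose_mul_factorial_mul_factorial hn).symm
  rw [hfac, Nat.cast_sub hn]
  ring

lemma negMulLog_add_sub_eq_mul_binEnt (A p : ℝ) :
    negMulLog (A * p) + negMulLog (A - A * p) - negMulLog A = A * binEnt p := by
  rw [show A - A * p = A * (1 - p) by ring, negMulLog_mul, negMulLog_mul]
  simp only [negMulLog, binEnt]
  ring

lemma tendsto_floor_mul_div {a : ℕ → ℕ} {A β : ℝ} (hβ : 0 ≤ β)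
    (ha : Tendsto (fun n => (a n : ℝ) / n) atTop (nhds A)) :
    Tendsto (fun n => (⌊β * (a n : ℝ)⌋₊ : ℝ) / n) atTop (nhds (A * β)) := by
  have hup : Tendsto (fun n => (a n : ℝ) / n * β) atTop (nhds (A * β)) := ha.mul_const β
  have hlow : Tendsto (fun n : ℕ => (a n : ℝ) / n * β - 1 / n) atTop (nhds (A * β)) := by
    simpa using hup.sub (tendsto_one_div_atTop_nhds_zero_nat (𝕜 := ℝ))
  refine tendsto_of_tendsto_of_tendsto_of_le_of_le hlow hup (fun n => ?_) (fun n => ?_)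
  · have := Nat.lt_floor_add_one (β * (a n : ℝ))
    calc (a n : ℝ) / n * β - 1 / n = (β * a n - 1) / n := by ring
      _ ≤ _ := by gcongr; linarith
  · have := Nat.floor_le (a := β * (a n : ℝ)) (by positivity)
    calc (⌊β * (a n : ℝ)⌋₊ : ℝ) / n ≤ (β * a n) / n := by gcongr
      _ = _ := by ring

lemma binEnt_one_sub (p : ℝ) : binEnt (1 - p) = binEnt p := by
  simp only [binEnt, sub_sub_cancel]
  ring

lemma rateR_eq_min (Ω α : ℝ) (hΩ : Ω < 1) :
    rateR Ω α = binEnt Ω - Ω * binEnt (min α (1 - Ω))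
      - (1 - Ω) * binEnt (Ω * min α (1 - Ω) / (1 - Ω)) := by
  rw [rateR]
  split_ifs with h
  · rw [min_eq_left h.le]
  · rw [min_eq_right (not_lt.1 h), mul_div_cancel_right₀ _ (by linarith : 1 - Ω ≠ 0),
      binEnt_one_sub]
    ring

/-- The exponential rate of the ratio of the Johnson space to one of its spheres. -/
lemma tendsto_log_choose_sub_log_sphere (Ω β : ℝ) (hΩ0 : 0 < Ω) (hΩ1 : Ω ≤ 1 / 2) (hβ0 : 0 ≤ β)
    {k m : ℕ → ℕ} (hk : ∀ n, k n = ⌊Ω * (n : ℝ)⌋₊)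
    (hm : ∀ n, m n = ⌊β * (k n : ℝ)⌋₊) (hkn : ∀ n, 2 * k n ≤ n) (hmk : ∀ n, m n ≤ k n) :
    Tendsto (fun n : ℕ => (log (n.choose (k n) : ℝ) - log ((k n).choose (m n) : ℝ)
      - log ((n - k n).choose (m n) : ℝ)) / n) atTop
      (nhds (binEnt Ω - Ω * binEnt β - (1 - Ω) * binEnt (Ω * β / (1 - Ω)))) := by
  have h1 : Tendsto (fun n : ℕ => ((n : ℕ) : ℝ) / n) atTop (nhds 1) := by
    refine tendsto_const_nhds.congr' ?_
    filter_upwards [eventually_gt_atTop 0] with n hn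
    rw [div_self (by positivity)]
  have hK : Tendsto (fun n => (k n : ℝ) / n) atTop (nhds Ω) := by
    have := tendsto_floor_mul_div hΩ0.le h1
    simpa [hk] using this
  have hM : Tendsto (fun n => (m n : ℝ) / n) atTop (nhds (Ω * β)) := by
    have := tendsto_floor_mul_div hβ0 hK
    simpa [← hm] using this
  have hL : Tendsto (fun n => ((n - k n : ℕ) : ℝ) / n) atTop (nhds (1 - Ω)) := by
    refine (h1.sub hK).congr fun n => ?_
    rw [Nat.cast_sub (by linarith [hkn n]), sub_div]
  have e1 := tendsto_log_choose (.of_forall fun n => (by linarith [hkn n] : k n ≤ n)) h1 hK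
  have e2 := tendsto_log_choose (.of_forall hmk) hK hM
  have e3 := tendsto_log_choose
    (.of_forall fun n => (by have := hkn n; have := hmk n; lia : m n ≤ n - k n)) hL hM
  have hlim := (e1.sub e2).sub e3
  have g1 := negMulLog_add_sub_eq_mul_binEnt 1 Ω
  have g2 := negMulLog_add_sub_eq_mul_binEnt Ω β
  have g3 := negMulLog_add_sub_eq_mul_binEnt (1 - Ω) (Ω * β / (1 - Ω))
  rw [mul_div_cancel₀ _ (by linarith : 1 - Ω ≠ 0)] at g3
  rw [one_mul, one_mul] at g1
  rw [g1, g2, g3] at hlim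
  refine hlim.congr fun n => ?_
  ring

end Asymptotics

/-- Lemma 1 of the paper: `(1/n)·log N_n(Ω,α) → R(Ω,α)` as `n → ∞`. -/
theorem stmt2 (Ω α : ℝ) (hΩ0 : 0 < Ω) (hΩ1 : Ω ≤ 1 / 2) (hα0 : 0 ≤ α) (hα1 : α ≤ 1) :
    Tendsto (fun n : ℕ => Real.log (Ncov Ω α n) / n) atTop (nhds (rateR Ω α)) := by
  set β := min α (1 - Ω) with hβ
  have hβ0 : 0 ≤ β := le_min hα0 (by linarith)
  have hβ1 : β ≤ 1 := (min_le_left _ _).trans hα1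
  set k : ℕ → ℕ := fun n => ⌊Ω * (n : ℝ)⌋₊ with hk
  set m : ℕ → ℕ := fun n => ⌊β * (k n : ℝ)⌋₊ with hm
  have hkle : ∀ n : ℕ, (k n : ℝ) ≤ Ω * n := fun n => Nat.floor_le (by positivity)
  have hmle : ∀ n : ℕ, (m n : ℝ) ≤ β * k n := fun n => Nat.floor_le (by positivity)
  have hkn : ∀ n, 2 * k n ≤ n := fun n => by
    have : (2 * k n : ℝ) ≤ n := by nlinarith [hkle n, (Nat.cast_nonneg n : (0 : ℝ) ≤ n)]
    exact_mod_cast this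
  have hmk : ∀ n, m n ≤ k n := fun n => by
    have : (m n : ℝ) ≤ k n := (hmle n).trans (mul_le_of_le_one_left (by positivity) hβ1)
    exact_mod_cast this
  have hk0 : ∀ᶠ n in atTop, 0 < k n :=
    ((tendsto_nat_floor_atTop.comp
      (tendsto_natCast_atTop_atTop.const_mul_atTop hΩ0)).eventually_gt_atTop 0)
  have hrate := tendsto_log_choose_sub_log_sphere Ω β hΩ0 hΩ1 hβ0
    (fun _ => rfl) (fun _ => rfl) hkn hmk
  rw [← rateR_eq_min Ω α (by linarith)] at hrate
  have hlog1 : Tendsto (fun n : ℕ => Real.log ((n : ℝ) + 1) / n) atTop (nhds 0) := by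
    have h2 : Tendsto (fun n : ℕ => Real.log 2 / n + Real.log n / n) atTop (nhds 0) := by
      simpa using (tendsto_const_div_atTop_nhds_zero_nat (Real.log 2)).add tendsto_log_natCast_div
    refine squeeze_zero' (.of_forall fun n => ?_) ?_ h2
    · exact div_nonneg (Real.log_nonneg (by linarith [(Nat.cast_nonneg n : (0 : ℝ) ≤ n)]))
        (by positivity)
    · filter_upwards [eventually_gt_atTop 0] with n hn
      have hn' : (1 : ℝ) ≤ n := by exact_mod_cast hn
      rw [← add_div, ← Real.log_mul (by norm_num) (by positivity)]
      gcongr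
      linarith
  have hCpos : ∀ n : ℕ, (0 : ℝ) < n.choose (k n) := fun n => by
    exact_mod_cast Nat.choose_pos (by linarith [hkn n])
  have hApos : ∀ n : ℕ, (0 : ℝ) < (k n).choose (m n) := fun n => by
    exact_mod_cast Nat.choose_pos (hmk n)
  have hBpos : ∀ n : ℕ, (0 : ℝ) < (n - k n).choose (m n) := fun n => by
    have := hkn n
    have := hmk n
    exact_mod_cast Nat.choose_pos (by lia)
  have hup : Tendsto (fun n : ℕ => (Real.log (n.choose (k n) : ℝ)
      - Real.log ((k n).choose (m n) : ℝ) - Real.log ((n - k n).choose (m n) : ℝ)) / n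
      + Real.log ((n : ℝ) + 1) / n) atTop (nhds (rateR Ω α)) := by
    simpa using hrate.add hlog1
  have hNup : ∀ᶠ n : ℕ in atTop, Real.log (Ncov Ω α n) / n
      ≤ (Real.log (n.choose (k n) : ℝ) - Real.log ((k n).choose (m n) : ℝ)
        - Real.log ((n - k n).choose (m n) : ℝ)) / n + Real.log ((n : ℝ) + 1) / n := by
    filter_upwards [hk0] with n hn
    have hNpos : (0 : ℝ) < Ncov Ω α n := by
      exact_mod_cast Ncov_pos (Ω := Ω) hα0 rfl hn (by linarith [hkn n])
    have hle := Ncov_le (Ω := Ω) (α := α) hα0 rfl hn (hkn n) (hmk n)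
      (Nat.floor_le_floor (mul_le_mul_of_nonneg_right (min_le_left _ _) (by positivity)))
    have hA := hApos n
    have hB := hBpos n
    have hC := hCpos n
    have hl := Real.log_le_log hNpos hle
    rw [Real.log_mul (by positivity) (by positivity), Real.log_div (by positivity) (by positivity),
      Real.log_mul (by positivity) (by positivity)] at hl
    rw [← add_div]
    gcongr
    linarith
  by_cases hα : α < 1 - Ω
  · have hβα : β = α := min_eq_left hα.le
    have hlow : Tendsto (fun n : ℕ => (Real.log (n.choose (k n) : ℝ)
        - Real.log ((k n).choose (m n) : ℝ) - Real.log ((n - k n).choose (m n) : ℝ)) / n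
        - Real.log ((n : ℝ) + 1) / n) atTop (nhds (rateR Ω α)) := by
      simpa using hrate.sub hlog1
    refine tendsto_of_tendsto_of_tendsto_of_le_of_le' hlow hup ?_ hNup
    filter_upwards [hk0] with n hn
    have hNpos : (0 : ℝ) < Ncov Ω α n := by
      exact_mod_cast Ncov_pos (Ω := Ω) hα0 rfl hn (by linarith [hkn n])
    have hmn : m n * n ≤ k n * (n - k n) := by
      have hreal : (m n : ℝ) * n ≤ k n * (n - k n) := by
        have hβn : β * n ≤ n - k n := by
          have : β * n ≤ (1 - Ω) * n := by gcongr; exact min_le_right _ _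
          linarith [hkle n]
        calc (m n : ℝ) * n ≤ β * k n * n := by gcongr; exact hmle n
          _ = k n * (β * n) := by ring
          _ ≤ _ := by gcongr
      rw [← Nat.cast_sub (by linarith [hkn n])] at hreal
      exact_mod_cast hreal
    have hle := choose_le_Ncov_mul (Ω := Ω) (α := α) hα0 rfl hn (hkn n) (m := m n)
      (by rw [← hβα]) (hmk n) hmn
    have hle' : (n.choose (k n) : ℝ)
        ≤ Ncov Ω α n * (((m n : ℝ) + 1) * ((k n).choose (m n) * (n - k n).choose (m n))) := by
      exact_mod_cast hle
    have hA := hApos n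
    have hB := hBpos n
    have hl := Real.log_le_log (hCpos n) hle'
    rw [Real.log_mul (by positivity) (by positivity), Real.log_mul (by positivity) (by positivity),
      Real.log_mul (by positivity) (by positivity)] at hl
    have hmlog : Real.log ((m n : ℝ) + 1) ≤ Real.log ((n : ℝ) + 1) := by
      have : m n ≤ n := by linarith [hkn n, hmk n]
      gcongr
    rw [← sub_div]
    gcongr
    linarith
  · have h0 : rateR Ω α = 0 := if_neg hα
    rw [h0] at hup ⊢
    exact squeeze_zero' (.of_forall fun n =>
      div_nonneg (Real.log_natCast_nonneg _) (by positivity)) hNup hup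
end

section
/- Let A be an m×n real matrix and let 1 ≤ k ≤ n. Let S be a uniformly random k-element subset of {1,…,n}. Then E[t_S] ≥ (n/k − 1)·(k − E[r_S]), where the expectations are averages over all C(n,k) subsets of size k. -/
/-- The rank `r_s` of the submatrix of `A` formed by the columns indexed by `s`:
the dimension of the span of those columns. -/
noncomputable def colRank {m n : ℕ} (A : Matrix (Fin m) (Fin n) ℝ) (s : Finset (Fin n)) : ℕ :=
  Module.finrank ℝ (Submodule.span ℝ ((fun j i => A i j) '' (s : Set (Fin n))))

open Classical in
/-- `t_s`: the number of indices `i ∉ s` whose column lies in the span of the columns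
indexed by `s`. -/
noncomputable def tCount {m n : ℕ} (A : Matrix (Fin m) (Fin n) ℝ) (s : Finset (Fin n)) : ℕ :=
  (sᶜ.filter fun i =>
    (fun i' => A i' i) ∈ Submodule.span ℝ ((fun j i' => A i' j) '' (s : Set (Fin n)))).card

open Classical in
/-- The indices `i ∈ s` whose column lies in the span of the other columns indexed by `s`. -/
noncomputable def dependentColumns {m n : ℕ} (A : Matrix (Fin m) (Fin n) ℝ)
    (s : Finset (Fin n)) : Finset (Fin n) :=
  s.filter fun i => (fun i' => A i' i) ∈
    Submodule.span ℝ ((fun j i' => A i' j) '' (s.erase i : Set (Fin n)))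

/-- At least `#s - colRank A s` columns of `s` lie in the span of the other columns of `s`. -/
theorem card_le_colRank_add_card_dependent {m n : ℕ} (A : Matrix (Fin m) (Fin n) ℝ)
    (s : Finset (Fin n)) :
    s.card ≤ colRank A s + (dependentColumns A s).card := by
  classical
  obtain ⟨b, hbs, -, hspan, hb⟩ := exists_linearIndepOn_extension
    (linearIndepOn_empty ℝ (fun j i => A i j)) (Set.empty_subset (s : Set (Fin n)))
  lift b to Finset (Fin n) using s.finite_toSet.subset hbs
  have hbs' : b ⊆ s := by exact_mod_cast hbs
  have hrank : b.card ≤ colRank A s := by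
    have hcard := finrank_span_eq_card hb
    rw [← Set.image_eq_range (fun j i => A i j), ← Nat.card_eq_fintype_card, Nat.card_coe_set_eq,
      Set.ncard_coe_finset] at hcard
    rw [← hcard]
    exact Submodule.finrank_mono (Submodule.span_mono (Set.image_mono hbs))
  have hdep : s \ b ⊆ dependentColumns A s := by
    intro i hi
    obtain ⟨his, hib⟩ := Finset.mem_sdiff.mp hi
    refine Finset.mem_filter.mpr ⟨his, ?_⟩
    refine Submodule.span_mono (Set.image_mono ?_) (hspan (Set.mem_image_of_mem _ his))
    exact_mod_cast Finset.subset_erase.mpr ⟨hbs', hib⟩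
  have := Finset.card_le_card hdep
  have := Finset.card_sdiff_add_card_eq_card hbs'
  omega

/-- Exchanging a dependent column `i ∈ s` for some `j ∉ s` gives a set whose span still
contains column `i`; this exchange is injective. -/
theorem sum_card_dependentColumns_mul_le {m n k : ℕ} (A : Matrix (Fin m) (Fin n) ℝ) :
    (∑ s ∈ Finset.univ.powersetCard k, (dependentColumns A s).card) * (n - k) ≤
      (∑ s ∈ Finset.univ.powersetCard k, tCount A s) * k := by
  classical
  let T : Finset (Fin n) → Finset (Fin n) := fun s => sᶜ.filter fun i =>
    (fun i' => A i' i) ∈ Submodule.span ℝ ((fun j i' => A i' j) '' (s : Set (Fin n)))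
  have hT : ∀ s, tCount A s = (T s).card := fun s => by
    unfold tCount
    congr!
  have hleft : (∑ s ∈ Finset.univ.powersetCard k, (dependentColumns A s).card) * (n - k) =
      ((Finset.univ.powersetCard k).sigma fun s => dependentColumns A s ×ˢ sᶜ).card := by
    rw [Finset.card_sigma, Finset.sum_mul]
    refine Finset.sum_congr rfl fun s hs => ?_
    rw [Finset.card_product, Finset.card_compl, (Finset.mem_powersetCard.mp hs).2,
      Fintype.card_fin]
  have hright : (∑ s ∈ Finset.univ.powersetCard k, tCount A s) * k =
      ((Finset.univ.powersetCard k).sigma fun s => T s ×ˢ s).card := by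
    rw [Finset.card_sigma, Finset.sum_mul]
    refine Finset.sum_congr rfl fun s hs => ?_
    rw [Finset.card_product, (Finset.mem_powersetCard.mp hs).2, hT]
  rw [hleft, hright]
  refine Finset.card_le_card_of_injOn
    (fun x => ⟨insert x.2.2 (x.1.erase x.2.1), x.2⟩) ?_ ?_
  · rintro ⟨s, i, j⟩ h
    simp only [Finset.coe_sigma, Set.mem_sigma_iff, Finset.mem_coe, Finset.mem_powersetCard,
      Finset.subset_univ, true_and, Finset.mem_product, Finset.mem_compl,
      dependentColumns, Finset.mem_filter, T] at h ⊢
    obtain ⟨hs, ⟨his, hspan⟩, hj⟩ := h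
    have hij : i ≠ j := fun h => hj (h ▸ his)
    refine ⟨?_, ⟨by simp [hij], ?_⟩, Finset.mem_insert_self _ _⟩
    · rw [Finset.card_insert_of_notMem (by simp [hj]), Finset.card_erase_add_one his, hs]
    · refine Submodule.span_mono (Set.image_mono ?_) hspan
      exact_mod_cast Finset.subset_insert _ _
  · rintro ⟨s, i, j⟩ h ⟨s', i', j'⟩ h' heq
    simp only [Finset.coe_sigma, Set.mem_sigma_iff, Finset.mem_coe, Finset.mem_product,
      Finset.mem_compl, dependentColumns, Finset.mem_filter] at h h'
    simp only [Sigma.mk.injEq, heq_eq_eq, Prod.mk.injEq] at heq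
    obtain ⟨hins, rfl, rfl⟩ := heq
    have herase : s.erase i = s'.erase i := by
      rw [← Finset.erase_insert (s := s.erase i) (a := j) (by simp [h.2.2]), hins,
        Finset.erase_insert (by simp [h'.2.2])]
    have hs : s = s' := by
      rw [← Finset.insert_erase h.2.1.1, herase, Finset.insert_erase h'.2.1.1]
    rw [hs]

/-- Lemma 3 of the paper: for `S` uniform over `k`-subsets,
`E[t_S] ≥ (n/k − 1)·(k − E[r_S])`, expectations being averages over all `C(n,k)` subsets. -/
theorem stmt3 (m n k : ℕ) (hk1 : 1 ≤ k) (hkn : k ≤ n) (A : Matrix (Fin m) (Fin n) ℝ) :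
    ((n : ℝ) / k - 1) *
        ((k : ℝ) - (∑ s ∈ Finset.univ.powersetCard k, (colRank A s : ℝ)) / (n.choose k : ℝ)) ≤
      (∑ s ∈ Finset.univ.powersetCard k, (tCount A s : ℝ)) / (n.choose k : ℝ) := by
  have hk : (0 : ℝ) < k := by exact_mod_cast hk1
  have hC : (0 : ℝ) < n.choose k := by exact_mod_cast Nat.choose_pos hkn
  have hnk : (0 : ℝ) ≤ n - k := sub_nonneg.mpr (by exact_mod_cast hkn)
  have hrank : (n.choose k : ℝ) * k ≤ ∑ s ∈ Finset.univ.powersetCard k, (colRank A s : ℝ) +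
      ∑ s ∈ Finset.univ.powersetCard k, ((dependentColumns A s).card : ℝ) := by
    rw [← Finset.sum_add_distrib]
    calc (n.choose k : ℝ) * k
        = ∑ s ∈ (Finset.univ : Finset (Fin n)).powersetCard k, (k : ℝ) := by simp
      _ ≤ _ := Finset.sum_le_sum fun s hs => by
        have h := card_le_colRank_add_card_dependent A s
        rw [(Finset.mem_powersetCard.mp hs).2] at h
        exact_mod_cast h
  have hexch : (∑ s ∈ Finset.univ.powersetCard k, ((dependentColumns A s).card : ℝ)) *
      (n - k) ≤ (∑ s ∈ Finset.univ.powersetCard k, (tCount A s : ℝ)) * k := by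
    have h := sum_card_dependentColumns_mul_le (k := k) A
    rw [← Nat.cast_le (α := ℝ)] at h
    push_cast [Nat.cast_sub hkn] at h
    exact h
  rw [div_sub_one hk.ne', sub_div' hC.ne', div_mul_div_comm, div_le_div_iff₀ (by positivity) hC]
  have := mul_le_mul_of_nonneg_right hrank hnk
  nlinarith
end

section
/- Let A be an m×n real matrix and let 1 ≤ k and k+1 ≤ n. Then the average of rank(A_V) over all (k+1)-element subsets V of {1,…,n} is at most (k+1)/k times the average of rank(A_s) over all k-element subsets s of {1,…,n}. -/
theorem colRank_mono {m n : ℕ} (A : Matrix (Fin m) (Fin n) ℝ) {s t : Finset (Fin n)}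
    (h : s ⊆ t) : colRank A s ≤ colRank A t :=
  Submodule.finrank_mono (Submodule.span_mono (Set.image_mono (Finset.coe_subset.2 h)))

theorem colRank_eq_card_of_linearIndepOn {m n : ℕ} (A : Matrix (Fin m) (Fin n) ℝ)
    {s : Finset (Fin n)} (h : LinearIndepOn ℝ (fun j i => A i j) (s : Set (Fin n))) :
    colRank A s = s.card := by
  have h' := finrank_span_eq_card (R := ℝ) h
  rw [colRank, Set.image_eq_range]
  exact h'.trans (by simp)

/-- Every set of columns contains a column basis of its span. -/
theorem exists_subset_linearIndepOn_card_eq_colRank {m n : ℕ} (A : Matrix (Fin m) (Fin n) ℝ)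
    (s : Finset (Fin n)) :
    ∃ b ⊆ s, LinearIndepOn ℝ (fun j i => A i j) (b : Set (Fin n)) ∧ b.card = colRank A s := by
  classical
  obtain ⟨b, hbs, -, hspan, hli⟩ := exists_linearIndepOn_extension
    (K := ℝ) (v := fun j i => A i j) (linearIndepOn_empty ℝ _) (Set.empty_subset (s : Set (Fin n)))
  lift b to Finset (Fin n) using b.toFinite
  have hbs' : b ⊆ s := Finset.coe_subset.1 hbs
  refine ⟨b, hbs', hli, le_antisymm ?_ ?_⟩
  · rw [← colRank_eq_card_of_linearIndepOn A hli]
    exact colRank_mono A hbs'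
  · rw [← colRank_eq_card_of_linearIndepOn A hli]
    exact Submodule.finrank_mono (Submodule.span_le.2 hspan)

theorem card_mul_colRank_le_sum_colRank_erase_add {m n : ℕ} (A : Matrix (Fin m) (Fin n) ℝ)
    (s : Finset (Fin n)) :
    s.card * colRank A s ≤ ∑ v ∈ s, colRank A (s.erase v) + colRank A s := by
  obtain ⟨b, hbs, hli, hcard⟩ := exists_subset_linearIndepOn_card_eq_colRank A s
  have hv (v : Fin n) : colRank A s ≤ colRank A (s.erase v) + if v ∈ b then 1 else 0 := by
    have h₁ := colRank_mono A (Finset.erase_subset_erase v hbs)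
    rw [colRank_eq_card_of_linearIndepOn A
      (hli.mono (Finset.coe_subset.2 (Finset.erase_subset v b))), Finset.card_erase_eq_ite] at h₁
    split_ifs at h₁ ⊢ <;> omega
  calc s.card * colRank A s = ∑ v ∈ s, colRank A s := by simp
    _ ≤ ∑ v ∈ s, (colRank A (s.erase v) + if v ∈ b then 1 else 0) :=
      Finset.sum_le_sum fun v _ => hv v
    _ = ∑ v ∈ s, colRank A (s.erase v) + colRank A s := by
      rw [Finset.sum_add_distrib, Finset.sum_ite_mem, Finset.inter_eq_right.2 hbs]
      simp [hcard]

theorem sum_powersetCard_succ_sum_erase {α : Type*} [Fintype α] [DecidableEq α] (k : ℕ)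
    (f : Finset α → ℕ) :
    ∑ t ∈ Finset.univ.powersetCard (k + 1), ∑ v ∈ t, f (t.erase v) =
      (Fintype.card α - k) * ∑ s ∈ Finset.univ.powersetCard k, f s := by
  have h : ∑ t ∈ Finset.univ.powersetCard (k + 1), ∑ v ∈ t, f (t.erase v) =
      ∑ s ∈ Finset.univ.powersetCard k, ∑ _v ∈ sᶜ, f s := by
    rw [Finset.sum_sigma', Finset.sum_sigma']
    refine Finset.sum_bij' (fun x _ => ⟨x.1.erase x.2, x.2⟩) (fun x _ => ⟨insert x.2 x.1, x.2⟩)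
      ?_ ?_ ?_ ?_ ?_
    · rintro ⟨t, v⟩ h
      simp only [Finset.mem_sigma, Finset.mem_powersetCard_univ] at h
      simp [Finset.card_erase_of_mem h.2, h.1]
    · rintro ⟨s, v⟩ h
      simp only [Finset.mem_sigma, Finset.mem_powersetCard_univ, Finset.mem_compl] at h
      simp [Finset.card_insert_of_notMem h.2, h.1]
    · rintro ⟨t, v⟩ h
      simp only [Finset.mem_sigma] at h
      simp [Finset.insert_erase h.2]
    · rintro ⟨s, v⟩ h
      simp only [Finset.mem_sigma, Finset.mem_compl] at h
      simp [Finset.erase_insert h.2]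
    · rintro ⟨t, v⟩ _
      rfl
  rw [h, Finset.mul_sum]
  refine Finset.sum_congr rfl fun s hs => ?_
  rw [Finset.sum_const, Finset.card_compl, Finset.mem_powersetCard_univ.1 hs, smul_eq_mul]

theorem mul_sum_colRank_powersetCard_succ_le {m n : ℕ} (k : ℕ) (A : Matrix (Fin m) (Fin n) ℝ) :
    k * ∑ V ∈ Finset.univ.powersetCard (k + 1), colRank A V ≤
      (n - k) * ∑ s ∈ Finset.univ.powersetCard k, colRank A s := by
  have h := sum_powersetCard_succ_sum_erase k (colRank A)
  rw [Fintype.card_fin] at h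
  rw [← h, Finset.mul_sum]
  refine Finset.sum_le_sum fun V hV => ?_
  have hle := card_mul_colRank_le_sum_colRank_erase_add A V
  rw [Finset.mem_powersetCard_univ.1 hV, add_one_mul] at hle
  omega

/-- Intermediate claim in Lemma 3 of the paper: the average of `rank(A_V)` over all
`(k+1)`-subsets `V` is at most `(k+1)/k` times the average of `rank(A_s)` over all
`k`-subsets `s`. -/
theorem stmt5 (m n k : ℕ) (hk1 : 1 ≤ k) (hkn : k + 1 ≤ n) (A : Matrix (Fin m) (Fin n) ℝ) :
    (∑ V ∈ Finset.univ.powersetCard (k + 1), (colRank A V : ℝ)) / (n.choose (k + 1) : ℝ) ≤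
      ((k : ℝ) + 1) / (k : ℝ) *
        ((∑ s ∈ Finset.univ.powersetCard k, (colRank A s : ℝ)) / (n.choose k : ℝ)) := by
  have hle := mul_sum_colRank_powersetCard_succ_le k A
  have hchoose := Nat.choose_succ_right_eq n k
  have hC₁ : (0 : ℝ) < n.choose (k + 1) := by exact_mod_cast Nat.choose_pos hkn
  have hC₀ : (0 : ℝ) < n.choose k := by exact_mod_cast Nat.choose_pos (Nat.le_of_succ_le hkn)
  have hk : (0 : ℝ) < k := by exact_mod_cast hk1
  rify at hle hchoose
  rw [div_mul_div_comm, div_le_div_iff₀ hC₁ (mul_pos hk hC₀)]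
  have h := mul_le_mul_of_nonneg_right hle hC₀.le
  linear_combination h - (∑ s ∈ Finset.univ.powersetCard k, (colRank A s : ℝ)) * hchoose
end

section
/- Let 1 ≤ k < n, let x ∈ ℝⁿ be a vector whose support s = {i : x_i ≠ 0} has exactly k elements, and let A be a (k+1)×n random matrix whose entries are i.i.d. standard Gaussian random variables. Then almost surely, for every k-element subset s' of {1,…,n} with s' ≠ s, the vector Ax does not lie in the linear span of the columns of A indexed by s'. In particular, almost surely s is the unique k-element subset s' of {1,…,n} such that Ax lies in the span of the columns of A indexed by s'. -/
open MeasureTheory ProbabilityTheory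

/-- Finite products of measures preserve absolute continuity. -/
theorem absolutelyContinuous_pi {ι : Type*} [Fintype ι] {α : ι → Type*}
    [∀ i, MeasurableSpace (α i)] {μ ν : ∀ i, Measure (α i)} [∀ i, SigmaFinite (μ i)]
    [∀ i, SigmaFinite (ν i)] (h : ∀ i, μ i ≪ ν i) : Measure.pi μ ≪ Measure.pi ν := by
  classical
  have : Encodable ι := Fintype.toEncodable ι
  rw [← Measure.pi'_eq_pi, ← Measure.pi'_eq_pi]
  refine Measure.AbsolutelyContinuous.map ?_ (measurable_tProd_elim' _)
  generalize Encodable.sortedUniv ι = l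
  induction l with
  | nil => exact Measure.AbsolutelyContinuous.rfl
  | cons i l ih =>
    rw [Measure.tprod_cons, Measure.tprod_cons]
    exact (h i).prod ih

/-- The linear map placing a vector in column `j₀` of an otherwise zero matrix. -/
def insertColumn {m ι : Type*} [DecidableEq ι] (j₀ : ι) : (m → ℝ) →ₗ[ℝ] (m × ι → ℝ) where
  toFun v p := if p.2 = j₀ then v p.1 else 0
  map_add' v w := by ext p; by_cases h : p.2 = j₀ <;> simp [h]
  map_smul' a v := by ext p; by_cases h : p.2 = j₀ <;> simp [h]

theorem measurableSet_mulVec_mem_span_columns {m ι : Type*} [Fintype m] [Fintype ι]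
    (x : ι → ℝ) (t : Finset ι) :
    MeasurableSet {A : m × ι → ℝ | (fun i => ∑ j, A (i, j) * x j) ∈
      Submodule.span ℝ ((fun j i => A (i, j)) '' (t : Set ι))} := by
  let Z : Set ((m × ι → ℝ) × (ι → ℝ)) :=
    {p | (∑ j ∈ t, p.2 j • fun i => p.1 (i, j)) = fun i => ∑ j, p.1 (i, j) * x j}
  have hZ : IsClosed Z := isClosed_eq (by fun_prop) (by fun_prop)
  obtain ⟨K, hK, hKZ⟩ := (isSigmaCompact_univ.of_isClosed_subset hZ
    (Set.subset_univ Z)).image continuous_fst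
  have hmeas : MeasurableSet (Prod.fst '' Z) := by
    rw [← hKZ]
    exact MeasurableSet.iUnion fun n => (hK n).measurableSet
  convert! hmeas using 1
  ext A
  simp [Z, Submodule.mem_span_image_finset_iff_exists_fun']

theorem ae_add_smul_notMem {E : Type*} [NormedAddCommGroup E] [NormedSpace ℝ E]
    [MeasurableSpace E] [BorelSpace E] [FiniteDimensional ℝ E] (μ : Measure E)
    [μ.IsAddHaarMeasure] {W : Submodule ℝ E} (hW : W ≠ ⊤) (b : E) {a : ℝ} (ha : a ≠ 0) :
    ∀ᵐ v ∂μ, b + a • v ∉ W := by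
  have h := Measure.addHaar_affineSubspace μ (AffineSubspace.mk' (-(a⁻¹ • b)) W) fun h => hW <| by
    rw [← AffineSubspace.direction_mk' (-(a⁻¹ • b)) W, h, AffineSubspace.direction_top]
  filter_upwards [measure_eq_zero_iff_ae_notMem.1 h] with v hv hmem
  refine hv (AffineSubspace.mem_mk'.2 ?_)
  convert! W.smul_mem a⁻¹ hmem using 1
  simp [smul_smul, ha, add_comm]

theorem ae_mulVec_notMem_span_columns {m ι : Type*} [Fintype m] [Fintype ι]
    (x : ι → ℝ) {t : Finset ι} (ht : t.card < Fintype.card m) {j₀ : ι} (hj₀ : j₀ ∉ t)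
    (hx : x j₀ ≠ 0) :
    ∀ᵐ A : m × ι → ℝ, (fun i => ∑ j, A (i, j) * x j) ∉
      Submodule.span ℝ ((fun j i => A (i, j)) '' (t : Set ι)) := by
  classical
  refine ae_mem_of_ae_add_linearMap_mem (insertColumn j₀) (volume : Measure (m → ℝ)) volume
    (measurableSet_mulVec_mem_span_columns x t).compl fun A => ?_
  have hW : Submodule.span ℝ ((fun j i => A (i, j)) '' (t : Set ι)) ≠ ⊤ := by
    intro h
    have hle := finrank_span_finset_le_card (R := ℝ) (t.image fun j (i : m) => A (i, j))
    rw [Finset.coe_image, Set.finrank, h, finrank_top, Module.finrank_fintype_fun_eq_card] at hle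
    exact (hle.trans Finset.card_image_le).not_gt ht
  filter_upwards [ae_add_smul_notMem volume hW (fun i => ∑ j, A (i, j) * x j) hx] with v hv hmem
  apply hv
  have hcol : (fun j (i : m) => (A + insertColumn j₀ v) (i, j)) '' (t : Set ι) =
      (fun j i => A (i, j)) '' (t : Set ι) := by
    refine Set.image_congr fun j hj => ?_
    have : j ≠ j₀ := fun h => hj₀ (h ▸ hj)
    simp [insertColumn, this]
  rw [← hcol]
  convert! hmem using 1
  ext i
  simp [insertColumn, add_mul, Finset.sum_add_distrib, ite_mul, mul_comm (x j₀)]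

/-- Achievability part of Proposition 2 of the paper: if `x ∈ ℝⁿ` has support `s` of size
`k` and `A` is a `(k+1)×n` matrix with i.i.d. standard Gaussian entries, then almost
surely `Ax` lies outside the span of the columns indexed by any `k`-subset `s' ≠ s`; in
particular `s` is almost surely the unique `k`-subset whose columns can produce `Ax`. -/
theorem stmt7 (n k : ℕ) (hk1 : 1 ≤ k) (hkn : k < n) (x : Fin n → ℝ)
    (s : Finset (Fin n)) (hs : s = Finset.univ.filter fun i => x i ≠ 0)
    (hcard : s.card = k) :
    ∀ᵐ A ∂(Measure.pi fun _ : Fin (k + 1) × Fin n => gaussianReal 0 1),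
      (∀ s' : Finset (Fin n), s'.card = k → s' ≠ s →
        (fun i => ∑ j, A (i, j) * x j) ∉
          Submodule.span ℝ ((fun j i => A (i, j)) '' (s' : Set (Fin n)))) ∧
      (∀ s' : Finset (Fin n), s'.card = k →
        (fun i => ∑ j, A (i, j) * x j) ∈
          Submodule.span ℝ ((fun j i => A (i, j)) '' (s' : Set (Fin n))) → s' = s) := by
  have hmain : ∀ᵐ A ∂(Measure.pi fun _ : Fin (k + 1) × Fin n => gaussianReal 0 1),
      ∀ s' : Finset (Fin n), s'.card = k → s' ≠ s →
        (fun i => ∑ j, A (i, j) * x j) ∉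
          Submodule.span ℝ ((fun j i => A (i, j)) '' (s' : Set (Fin n))) := by
    refine ae_all_iff.2 fun s' => ?_
    by_cases h : s'.card = k ∧ s' ≠ s
    · obtain ⟨hc, hne⟩ := h
      obtain ⟨j₀, hj₀s, hj₀⟩ : ∃ j ∈ s, j ∉ s' := Finset.not_subset.1 fun hsub =>
        hne (Finset.eq_of_subset_of_card_le hsub (by omega)).symm
      have hxj : x j₀ ≠ 0 := by simpa [hs] using hj₀s
      have hac : (Measure.pi fun _ : Fin (k + 1) × Fin n => gaussianReal 0 1) ≪ volume :=
        absolutelyContinuous_pi fun _ => gaussianReal_absolutelyContinuous 0 one_ne_zero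
      filter_upwards [hac.ae_le (ae_mulVec_notMem_span_columns x (m := Fin (k + 1)) (t := s')
        (by simp [hc]) hj₀ hxj)] with A hA _ _ using hA
    · exact Filter.Eventually.of_forall fun A hc hne => (h ⟨hc, hne⟩).elim
  filter_upwards [hmain] with A hA
  exact ⟨hA, fun s' hc hmem => by_contra fun hne => hA s' hc hne hmem⟩
end

section
/- For every r > 0 and every γ ≥ 0, 𝒱(r,γ) ≥ min{r,1}·(1/2)·log(1 + γ/e). -/
/-- `Δ(r) = (1−r)^{1−1/r}` for `0 < r < 1`, with `Δ(1) = 1`. -/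
noncomputable def deltaFun (r : ℝ) : ℝ := if r = 1 then 1 else (1 - r) ^ (1 - 1 / r)

/-- The function `𝒱(r,γ)` of the paper. -/
noncomputable def calV (r γ : ℝ) : ℝ :=
  if r ≤ 1 then r / 2 * Real.log (1 + γ / Real.exp 1 * deltaFun r)
  else 1 / 2 * Real.log (1 + r * γ / Real.exp 1 * deltaFun (1 / r))

theorem one_le_deltaFun {r : ℝ} (h0 : 0 < r) (h1 : r ≤ 1) : 1 ≤ deltaFun r := by
  unfold deltaFun
  split_ifs with h
  · exact le_rfl
  · have hlt : r < 1 := lt_of_le_of_ne h1 h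
    have hinv : 1 ≤ 1 / r := (one_le_div h0).2 h1
    exact Real.one_le_rpow_of_pos_of_le_one_of_nonpos (by linarith) (by linarith) (by linarith)

/-- Equation (22) of the paper: `𝒱(r,γ) ≥ min{r,1}·(1/2)·log(1 + γ/e)`. -/
theorem stmt11 (r γ : ℝ) (hr : 0 < r) (hγ : 0 ≤ γ) :
    min r 1 * (1 / 2 * Real.log (1 + γ / Real.exp 1)) ≤ calV r γ := by
  have hx : 0 ≤ γ / Real.exp 1 := by positivity
  unfold calV
  split_ifs with h
  · have hΔ := one_le_deltaFun hr h
    have hlog : Real.log (1 + γ / Real.exp 1) ≤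
        Real.log (1 + γ / Real.exp 1 * deltaFun r) :=
      Real.log_le_log (by positivity) (by nlinarith)
    rw [min_eq_left h]
    nlinarith [mul_le_mul_of_nonneg_left hlog hr.le]
  · have h1 : 1 < r := not_le.1 h
    have hΔ := one_le_deltaFun (one_div_pos.2 hr) ((div_le_one hr).2 h1.le)
    have hfac : 1 ≤ r * deltaFun (1 / r) := by nlinarith
    have hlog : Real.log (1 + γ / Real.exp 1) ≤
        Real.log (1 + r * γ / Real.exp 1 * deltaFun (1 / r)) := by
      refine Real.log_le_log (by positivity) ?_
      have := mul_le_mul_of_nonneg_left hfac hx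
      have heq : r * γ / Real.exp 1 * deltaFun (1 / r) =
          γ / Real.exp 1 * (r * deltaFun (1 / r)) := by ring
      linarith
    rw [min_eq_right h1.le]
    linarith
end

section
/- For every r > 0 and every γ > 0, 0 ≤ 𝒢(r,γ) ≤ (r/2)·log(1 + γ). -/
/-- `ξ(r,γ)` from the Marčenko–Pastur / Shannon-transform formula. -/
noncomputable def xiFun (r γ : ℝ) : ℝ :=
  1 / 4 * (Real.sqrt (γ * (Real.sqrt r + 1) ^ 2 + 1) -
    Real.sqrt (γ * (Real.sqrt r - 1) ^ 2 + 1)) ^ 2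

/-- The function `𝒢(r,γ)` of the paper (asymptotic normalized log-determinant). -/
noncomputable def calG (r γ : ℝ) : ℝ :=
  1 / 2 * (r * Real.log (1 + γ - xiFun r γ) + Real.log (1 + r * γ - xiFun r γ) -
    xiFun r γ / γ)

theorem xiFun_quadratic {r γ : ℝ} (hr : 0 < r) (hγ : 0 < γ) :
    (γ - xiFun r γ) * (r * γ - xiFun r γ) = xiFun r γ ∧
      2 * xiFun r γ ≤ γ * (r + 1) + 1 := by
  have hs : Real.sqrt r ^ 2 = r := Real.sq_sqrt hr.le
  have hA : Real.sqrt (γ * (Real.sqrt r + 1) ^ 2 + 1) ^ 2 = γ * (Real.sqrt r + 1) ^ 2 + 1 :=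
    Real.sq_sqrt (by positivity)
  have hB : Real.sqrt (γ * (Real.sqrt r - 1) ^ 2 + 1) ^ 2 = γ * (Real.sqrt r - 1) ^ 2 + 1 :=
    Real.sq_sqrt (by positivity)
  have hA0 := Real.sqrt_nonneg (γ * (Real.sqrt r + 1) ^ 2 + 1)
  have hB0 := Real.sqrt_nonneg (γ * (Real.sqrt r - 1) ^ 2 + 1)
  unfold xiFun
  set s := Real.sqrt r
  set A := Real.sqrt (γ * (s + 1) ^ 2 + 1)
  set B := Real.sqrt (γ * (s - 1) ^ 2 + 1)
  have hsum : A ^ 2 + B ^ 2 = 2 * (γ * (r + 1) + 1) := by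
    rw [hA, hB, ← hs]; ring
  have hprod : A ^ 2 * B ^ 2 = (γ * (r + 1) + 1) ^ 2 - 4 * γ ^ 2 * r := by
    rw [hA, hB, ← hs]; ring
  have hxi : 1 / 4 * (A - B) ^ 2 = (γ * (r + 1) + 1 - A * B) / 2 := by
    linear_combination hsum / 4
  rw [hxi]
  constructor
  · linear_combination hprod / 4
  · linarith [mul_nonneg hA0 hB0]

theorem xiFun_lt {r γ : ℝ} (hr : 0 < r) (hγ : 0 < γ) :
    xiFun r γ < γ ∧ xiFun r γ < r * γ := by
  obtain ⟨hq, hle⟩ := xiFun_quadratic hr hγ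
  have h0 : 0 ≤ xiFun r γ := by unfold xiFun; positivity
  have hrγ := mul_pos hr hγ
  have hpos : 0 < xiFun r γ := by
    refine h0.lt_of_ne fun h => ?_
    rw [← h] at hq
    nlinarith [mul_pos hγ hrγ]
  rw [← hq] at hpos
  rcases mul_pos_iff.mp hpos with ⟨h1, h2⟩ | ⟨h1, h2⟩
  · exact ⟨sub_pos.mp h1, sub_pos.mp h2⟩
  · nlinarith

theorem mul_log_one_add_le_log_one_add_mul {b c : ℝ} (hb : 0 ≤ b) (hc0 : 0 ≤ c) (hc1 : c ≤ 1) :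
    c * Real.log (1 + b) ≤ Real.log (1 + c * b) := by
  rw [← Real.log_rpow (by linarith)]
  exact Real.log_le_log (Real.rpow_pos_of_pos (by linarith) _)
    (rpow_one_add_le_one_add_mul_self (by linarith) hc0 hc1)

theorem log_one_add_sub_div_le {a b : ℝ} (ha : 0 < a) (hb : 0 < b) :
    Real.log (1 + b) - b / (1 + b) ≤
      b * (1 + a) / (a * (1 + b)) * (Real.log (1 + a + a * b) - Real.log (1 + a)) := by
  have hlog : Real.log (1 + a + a * b) - Real.log (1 + a) = Real.log (1 + a / (1 + a) * b) := by
    rw [← Real.log_div (by positivity) (by positivity)]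
    congr 1
    field_simp
  have hconc : a / (1 + a) * Real.log (1 + b) ≤ Real.log (1 + a / (1 + a) * b) :=
    mul_log_one_add_le_log_one_add_mul hb.le (by positivity)
      ((div_le_one (by positivity)).mpr (by linarith))
  have hlin : Real.log (1 + b) ≤ b := by
    linarith [Real.log_le_sub_one_of_pos (show 0 < 1 + b by linarith)]
  rw [hlog]
  calc Real.log (1 + b) - b / (1 + b)
      ≤ b / (1 + b) * Real.log (1 + b) := by
        rw [div_mul_eq_mul_div, sub_le_iff_le_add, ← add_div, le_div_iff₀ (by positivity)]
        linarith
    _ = b * (1 + a) / (a * (1 + b)) * (a / (1 + a) * Real.log (1 + b)) := by field_simp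
    _ ≤ _ := mul_le_mul_of_nonneg_left hconc (by positivity)

/-- `0 ≤ 𝒢(r,γ) ≤ (r/2)·log(1+γ)` for all `r, γ > 0`. -/
theorem stmt12 (r γ : ℝ) (hr : 0 < r) (hγ : 0 < γ) :
    0 ≤ calG r γ ∧ calG r γ ≤ r / 2 * Real.log (1 + γ) := by
  obtain ⟨hq, -⟩ := xiFun_quadratic hr hγ
  obtain ⟨h1, h2⟩ := xiFun_lt hr hγ
  unfold calG
  generalize xiFun r γ = x at *
  obtain ⟨a, rfl⟩ : ∃ a, γ = x + a := ⟨γ - x, by ring⟩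
  obtain ⟨b, hb⟩ : ∃ b, r * (x + a) = x + b := ⟨r * (x + a) - x, by ring⟩
  have ha0 : 0 < a := by linarith
  have hb0 : 0 < b := by linarith
  have hx : x = a * b := by rw [hb] at hq; linarith
  subst hx
  have hr' : r = b * (1 + a) / (a * (1 + b)) := by
    rw [eq_div_iff (by positivity)]
    linarith
  have hdiv : a * b / (a * b + a) = b / (1 + b) := by field_simp; ring
  rw [hb, hdiv, show 1 + (a * b + a) - a * b = 1 + a by ring,
    show 1 + (a * b + b) - a * b = 1 + b by ring,
    show 1 + (a * b + a) = 1 + a + a * b by ring]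
  constructor
  · have hlog : b / (1 + b) ≤ Real.log (1 + b) := by
      have h := Real.one_sub_inv_le_log_of_pos (show 0 < 1 + b by linarith)
      have he : b / (1 + b) = 1 - (1 + b)⁻¹ := by field_simp; ring
      rwa [he]
    have := mul_nonneg hr.le (Real.log_nonneg (show 1 ≤ 1 + a by linarith))
    linarith
  · have h := log_one_add_sub_div_le ha0 hb0
    rw [← hr'] at h
    linarith
end

section
/- Fix α ∈ (0,1). Then lim_{Ω→0⁺} R(Ω,α)/H(Ω) = 1 − α. In particular, for α = 1/2 there exists a constant C > 0 such that R(x,1/2) ≥ C·H(x) for all x ∈ (0,1/3]. -/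
open Filter

theorem binEnt_eq_binEntropy : binEnt = Real.binEntropy := by
  ext p
  simp only [binEnt, Real.binEntropy, Real.log_inv]
  ring

theorem tendsto_inv_neg_log_nhdsGT_zero :
    Tendsto (fun x : ℝ => (-Real.log x)⁻¹) (nhdsWithin 0 (Set.Ioi 0)) (nhds 0) :=
  (tendsto_neg_atBot_atTop.comp Real.tendsto_log_nhdsGT_zero).inv_tendsto_atTop

/-- If `u x ~ c x` as `x → 0⁺` then `H(u x) / (x log (1/x)) → c`. -/
theorem tendsto_binEnt_div {u : ℝ → ℝ} {c : ℝ} (hc : 0 < c)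
    (hu : Tendsto (fun x => u x / x) (nhdsWithin 0 (Set.Ioi 0)) (nhds c)) :
    Tendsto (fun x => binEnt (u x) / (x * -Real.log x)) (nhdsWithin 0 (Set.Ioi 0)) (nhds c) := by
  have hx0 : Tendsto (fun x : ℝ => x) (nhdsWithin 0 (Set.Ioi 0)) (nhds 0) :=
    tendsto_nhdsWithin_of_tendsto_nhds tendsto_id
  have hu0 : Tendsto u (nhdsWithin 0 (Set.Ioi 0)) (nhds 0) := by
    have h := hu.mul hx0
    rw [mul_zero] at h
    refine h.congr' ?_
    filter_upwards [self_mem_nhdsWithin] with x hx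
    exact div_mul_cancel₀ _ (ne_of_gt hx)
  set g : ℝ → ℝ := dslope (fun v => Real.log (1 - v)) 0 with hg
  have hgc : ContinuousAt g 0 := by
    rw [hg, continuousAt_dslope_same]
    exact ((differentiableAt_id).const_sub 1).log (by simp)
  have hgv (v : ℝ) : Real.log (1 - v) = v * g v := by
    have := sub_smul_dslope (fun v => Real.log (1 - v)) 0 v
    simpa using this.symm
  have hlim := ((hu.mul (hu.log hc.ne')).neg.mul tendsto_inv_neg_log_nhdsGT_zero).add
    (hu.sub ((((hu0.const_sub 1).mul hu).mul (hgc.tendsto.comp hu0)).mul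
      tendsto_inv_neg_log_nhdsGT_zero))
  simp only [mul_zero, sub_zero, zero_add] at hlim
  refine hlim.congr' ?_
  filter_upwards [self_mem_nhdsWithin, hu.eventually_ne hc.ne',
    Ioo_mem_nhdsGT (zero_lt_one' ℝ)] with x hx hux hx1
  have hx' : x ≠ 0 := ne_of_gt hx
  have hu' : u x ≠ 0 := fun h => hux (by simp [h])
  have hl : Real.log x ≠ 0 := (Real.log_neg hx1.1 hx1.2).ne
  simp only [binEnt, hgv, Function.comp]
  rw [Real.log_div hu' hx']
  field_simp
  ring

theorem tendsto_rateR_div_binEnt {α : ℝ} (hα0 : 0 < α) (hα1 : α < 1) :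
    Tendsto (fun Ω : ℝ => rateR Ω α / binEnt Ω) (nhdsWithin 0 (Set.Ioi 0)) (nhds (1 - α)) := by
  have hx0 : Tendsto (fun x : ℝ => x) (nhdsWithin 0 (Set.Ioi 0)) (nhds 0) :=
    tendsto_nhdsWithin_of_tendsto_nhds tendsto_id
  have h1 : Tendsto (fun x : ℝ => binEnt x / (x * -Real.log x))
      (nhdsWithin 0 (Set.Ioi 0)) (nhds 1) := by
    refine tendsto_binEnt_div one_pos (tendsto_const_nhds.congr' ?_)
    filter_upwards [self_mem_nhdsWithin] with x hx
    exact (div_self (ne_of_gt hx)).symm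
  have h2 : Tendsto (fun x : ℝ => binEnt (x * α / (1 - x)) / (x * -Real.log x))
      (nhdsWithin 0 (Set.Ioi 0)) (nhds α) := by
    refine tendsto_binEnt_div hα0 ?_
    have h : Tendsto (fun x : ℝ => α / (1 - x)) (nhdsWithin 0 (Set.Ioi 0)) (nhds (α / (1 - 0))) :=
      (tendsto_const_nhds (x := α)).div (hx0.const_sub 1) (by norm_num)
    rw [sub_zero, div_one] at h
    refine h.congr' ?_
    filter_upwards [self_mem_nhdsWithin] with x hx
    have hx' : x ≠ 0 := ne_of_gt hx
    rw [mul_div_assoc, mul_div_cancel_left₀ _ hx']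
  have hlim := ((h1.sub (tendsto_inv_neg_log_nhdsGT_zero.const_mul (binEnt α))).sub
    ((hx0.const_sub 1).mul h2)).div h1 one_ne_zero
  simp only [mul_zero, sub_zero, one_mul, div_one] at hlim
  refine hlim.congr' ?_
  filter_upwards [self_mem_nhdsWithin, Ioo_mem_nhdsGT (zero_lt_one' ℝ),
    Ioo_mem_nhdsGT (sub_pos.2 hα1)] with x hx hx1 hxα
  have hx' : x ≠ 0 := ne_of_gt hx
  have hl : Real.log x ≠ 0 := (Real.log_neg hx1.1 hx1.2).ne
  have hD : x * -Real.log x ≠ 0 := mul_ne_zero hx' (neg_ne_zero.2 hl)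
  have hR : rateR x α = binEnt x - x * binEnt α - (1 - x) * binEnt (x * α / (1 - x)) :=
    if_pos (by linarith [hxα.2])
  rw [Pi.div_apply, ← div_div_div_cancel_right₀ hD (rateR x α), hR]
  congr 1
  field_simp
  ring

theorem rateR_half_eq {x : ℝ} (hx : x < 1 / 2) :
    rateR x (1 / 2) =
      binEnt x - x * binEnt (1 / 2) - (1 - x) * binEnt (x * (1 / 2) / (1 - x)) :=
  if_pos (by linarith)

theorem rateR_half_pos {x : ℝ} (hx0 : 0 < x) (hx : x < 1 / 2) : 0 < rateR x (1 / 2) := by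
  rw [rateR_half_eq hx, binEnt_eq_binEntropy]
  have h1 : 0 < 1 - x := by linarith
  have hq : x * (1 / 2) / (1 - x) < 1 / 2 := by
    rw [div_lt_iff₀ h1]; linarith
  have hq0 : 0 ≤ x * (1 / 2) / (1 - x) := by positivity
  have h := Real.strictConcave_binEntropy.2 (x := 1 / 2) (by norm_num)
    (y := x * (1 / 2) / (1 - x)) ⟨hq0, by linarith⟩ hq.ne' hx0 h1 (by ring)
  have hmean : x * (1 / 2) + (1 - x) * (x * (1 / 2) / (1 - x)) = x := by
    field_simp; ring
  simp only [smul_eq_mul] at h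
  rw [hmean] at h
  linarith

theorem exists_mul_binEnt_le_rateR_half :
    ∃ C : ℝ, 0 < C ∧ ∀ x ∈ Set.Ioc (0 : ℝ) (1 / 3), C * binEnt x ≤ rateR x (1 / 2) := by
  have hH {x : ℝ} (h0 : 0 < x) (h1 : x ≤ 1 / 3) : 0 < binEnt x := by
    rw [binEnt_eq_binEntropy]
    exact Real.binEntropy_pos h0 (by linarith)
  have hev := (tendsto_rateR_div_binEnt (α := 1 / 2) (by norm_num) (by norm_num)).eventually_const_lt
    (u := 1 / 4) (by norm_num)
  obtain ⟨δ, hδ0, hδ⟩ := mem_nhdsGT_iff_exists_Ioo_subset.1 hev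
  have hδ0 : 0 < δ := hδ0
  have hcont : ContinuousOn (fun x => rateR x (1 / 2) / binEnt x) (Set.Icc δ (1 / 3)) := by
    have hb : Continuous binEnt := binEnt_eq_binEntropy ▸ Real.binEntropy_continuous
    refine ContinuousOn.div ?_ hb.continuousOn fun x hx => (hH (hδ0.trans_le hx.1) hx.2).ne'
    have hne : ∀ x ∈ Set.Icc δ (1 / 3), 1 - x ≠ 0 := fun x hx => by linarith [hx.2]
    refine ContinuousOn.congr (f := fun x =>
      binEnt x - x * binEnt (1 / 2) - (1 - x) * binEnt (x * (1 / 2) / (1 - x))) ?_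
      fun x hx => rateR_half_eq (by linarith [hx.2])
    have hq : ContinuousOn (fun x : ℝ => x * (1 / 2) / (1 - x)) (Set.Icc δ (1 / 3)) :=
      ContinuousOn.div (by fun_prop) (by fun_prop) hne
    have := hb.comp_continuousOn hq
    fun_prop
  obtain ⟨m, hm0, hm⟩ : ∃ m : ℝ, 0 < m ∧
      ∀ x ∈ Set.Icc δ (1 / 3), m ≤ rateR x (1 / 2) / binEnt x :=
    isCompact_Icc.exists_forall_le' hcont fun x hx =>
      div_pos (rateR_half_pos (hδ0.trans_le hx.1) (by linarith [hx.2]))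
        (hH (hδ0.trans_le hx.1) hx.2)
  refine ⟨min (1 / 4) m, by positivity, fun x hx => ?_⟩
  rw [← le_div_iff₀ (hH hx.1 hx.2)]
  rcases lt_or_ge x δ with h | h
  · exact (min_le_left _ _).trans (le_of_lt (hδ ⟨hx.1, h⟩))
  · exact (min_le_right _ _).trans (hm x ⟨h, hx.2⟩)

/-- Small-`Ω` asymptotic of the rate function (used in Propositions 7 and 9 of the paper):
for fixed `α ∈ (0,1)`, `R(Ω,α)/H(Ω) → 1 − α` as `Ω → 0⁺`; in particular there is
`C > 0` with `R(x,1/2) ≥ C·H(x)` for all `x ∈ (0,1/3]`. -/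
theorem stmt17 (α : ℝ) (hα0 : 0 < α) (hα1 : α < 1) :
    Tendsto (fun Ω : ℝ => rateR Ω α / binEnt Ω) (nhdsWithin 0 (Set.Ioi 0))
        (nhds (1 - α)) ∧
      ∃ C : ℝ, 0 < C ∧ ∀ x ∈ Set.Ioc (0 : ℝ) (1 / 3), C * binEnt x ≤ rateR x (1 / 2) := by
  exact ⟨tendsto_rateR_div_binEnt hα0 hα1, exists_mul_binEnt_le_rateR_half⟩
end
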